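/- Let k ≥ 0 be an integer and let G be a finite simple graph all of whose internal vertices are of type 0 or type 1, such that G_0 has at least one vertex; let n_0 be the maximum number of vertices in a connected component of G_0. Then μ_α(G) ≤ k if and only if μ_α(G_0) ≤ k and for every independent set I of G contained in V(G_1) with |I| ≤ (k+1)·n_0 it holds that α(G_0) − i(G_0 − N(I)) ≤ k, where N(I) is the neighborhood of I in G and G_0 − N(I) is the subgraph of G induced on V(G_0) ∖ N(I). -/

import Mathlib

/-- `s` is an independent set in `G`: no two vertices of `s` are adjacent. -/
def IndepSet {V : Type*} (G : SimpleGraph V) (s : Set V) : Prop :=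
  ∀ ⦃a⦄, a ∈ s → ∀ ⦃b⦄, b ∈ s → ¬ G.Adj a b

/-- `s` is a maximal independent set in `G`. -/
def MaxIndepSet {V : Type*} (G : SimpleGraph V) (s : Set V) : Prop :=
  IndepSet G s ∧ ∀ t : Set V, IndepSet G t → s ⊆ t → s = t

/-- `α(G)`: the maximum size of an independent set of `G`. -/
noncomputable def alphaNum {V : Type*} (G : SimpleGraph V) : ℕ :=
  sSup {n | ∃ s : Set V, IndepSet G s ∧ s.ncard = n}

/-- `i(G)`: the minimum size of a maximal independent set of `G`. -/
noncomputable def iNum {V : Type*} (G : SimpleGraph V) : ℕ :=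
  sInf {n | ∃ s : Set V, MaxIndepSet G s ∧ s.ncard = n}

/-- The independence gap `μ_α(G) = α(G) - i(G)`. -/
noncomputable def indepGap {V : Type*} (G : SimpleGraph V) : ℕ :=
  alphaNum G - iNum G

/-- `G` is well-covered: all maximal independent sets have the same size. -/
def WellCovered {V : Type*} (G : SimpleGraph V) : Prop :=
  alphaNum G = iNum G

/-- `G` is almost well-covered: its independence gap equals 1. -/
def AlmostWellCovered {V : Type*} (G : SimpleGraph V) : Prop :=
  indepGap G = 1

/-- The (open) neighborhood `N(I)` of a set of vertices `I`. -/
def nbhd {V : Type*} (G : SimpleGraph V) (I : Set V) : Set V :=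
  {v | ∃ u ∈ I, G.Adj u v}

/-- `U(G)`: the set of vertices whose connected component induces a complete graph. -/
def completeU {V : Type*} (G : SimpleGraph V) : Set V :=
  {u | G.IsClique (G.connectedComponentMk u).supp}

/-- A leaf: a vertex of the graph `G - U(G)` having degree 1 there. -/
def IsLeaf {V : Type*} (G : SimpleGraph V) (v : V) : Prop :=
  v ∉ completeU G ∧ {u | u ∉ completeU G ∧ G.Adj v u}.ncard = 1

/-- An internal vertex: a vertex of `G - U(G)` that is not a leaf. -/
def IsInternal {V : Type*} (G : SimpleGraph V) (v : V) : Prop :=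
  v ∉ completeU G ∧ ¬ IsLeaf G v

/-- A vertex has type `k` if it is an internal vertex adjacent to exactly `k` leaves;
in addition every vertex of `U(G)` has type `0`. -/
def HasType {V : Type*} (G : SimpleGraph V) (v : V) (k : ℕ) : Prop :=
  (IsInternal G v ∧ {u | IsLeaf G u ∧ G.Adj v u}.ncard = k) ∨ (v ∈ completeU G ∧ k = 0)

/-- The set of vertices of type `k`; `G_k` is the subgraph induced by this set. -/
def typeSet {V : Type*} (G : SimpleGraph V) (k : ℕ) : Set V :=
  {v | HasType G v k}

/-- The maximum number of vertices in a connected component of `G`. -/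
noncomputable def maxCompCard {V : Type*} (G : SimpleGraph V) : ℕ :=
  sSup {n | ∃ c : G.ConnectedComponent, c.supp.ncard = n}

/-- `G` has no cycle of length `n`. -/
def NoCycleOfLength {V : Type*} (G : SimpleGraph V) (n : ℕ) : Prop :=
  ∀ (v : V) (w : G.Walk v v), w.IsCycle → w.length ≠ n

/-- `G` has girth at least 6: no cycle of length 3, 4, or 5. -/
def GirthAtLeastSix {V : Type*} (G : SimpleGraph V) : Prop :=
  NoCycleOfLength G 3 ∧ NoCycleOfLength G 4 ∧ NoCycleOfLength G 5

/-- A pendant edge: an edge incident with a vertex of degree 1. -/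
def pendantEdges {V : Type*} (G : SimpleGraph V) : Set (Sym2 V) :=
  {e | e ∈ G.edgeSet ∧ ∃ v ∈ e, (G.neighborSet v).ncard = 1}

/-- The pendant edges of `G` are pairwise disjoint and cover every vertex of `G`. -/
def PendantPerfectMatching {V : Type*} (G : SimpleGraph V) : Prop :=
  (∀ e ∈ pendantEdges G, ∀ f ∈ pendantEdges G, e ≠ f → ∀ v : V, v ∈ e → v ∉ f) ∧
  (∀ v : V, ∃ e ∈ pendantEdges G, v ∈ e)

open Set

/-- `J` is a maximal independent set of the subgraph of `G` induced by `S`. -/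
def IsMaxIndepIn {V : Type*} (G : SimpleGraph V) (S J : Set V) : Prop :=
  J ⊆ S ∧ IndepSet G J ∧ ∀ v ∈ S, v ∉ J → ∃ u ∈ J, G.Adj u v

lemma maxIndepSet_iff {V : Type*} (G : SimpleGraph V) (s : Set V) :
    MaxIndepSet G s ↔ IsMaxIndepIn G univ s := by
  constructor
  · rintro ⟨hs, hmax⟩
    refine ⟨subset_univ _, hs, fun v _ hv => ?_⟩
    by_contra! hcon
    refine hv ?_
    rw [hmax (insert v s) ?_ (subset_insert _ _)]
    · exact mem_insert _ _
    · rintro a (rfl | ha) b (rfl | hb) hab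
      · exact G.irrefl hab
      · exact hcon b hb hab.symm
      · exact hcon a ha hab
      · exact hs ha hb hab
  · rintro ⟨-, hs, hmax⟩
    refine ⟨hs, fun t ht hst => hst.antisymm fun v hv => ?_⟩
    by_contra hvs
    obtain ⟨u, hu, huv⟩ := hmax v (mem_univ v) hvs
    exact ht (hst hu) hv huv

lemma MaxIndepSet.iNum_le_ncard {V : Type*} {G : SimpleGraph V} {s : Set V} (hs : MaxIndepSet G s) :
    iNum G ≤ s.ncard :=
  Nat.sInf_le ⟨s, hs, rfl⟩

lemma IsMaxIndepIn.iNum_induce_le {V : Type*} {G : SimpleGraph V} {S J : Set V}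
    (hJ : IsMaxIndepIn G S J) :
    iNum (G.induce S) ≤ J.ncard := by
  have h : MaxIndepSet (G.induce S) (Subtype.val ⁻¹' J) := by
    rw [maxIndepSet_iff]
    refine ⟨subset_univ _, fun a ha b hb hab => hJ.2.1 ha hb hab, fun v _ hv => ?_⟩
    obtain ⟨u, hu, huv⟩ := hJ.2.2 v v.2 hv
    exact ⟨⟨u, hJ.1 hu⟩, hu, huv⟩
  have hcard := h.iNum_le_ncard
  rwa [ncard_preimage_of_injective_subset_range Subtype.val_injective (by simpa using hJ.1)] at hcard

section Numbers

variable {V : Type*} [Finite V] (G : SimpleGraph V)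

lemma IndepSet.ncard_le_alphaNum {G : SimpleGraph V} {s : Set V} (hs : IndepSet G s) :
    s.ncard ≤ alphaNum G := by
  refine le_csSup ⟨Nat.card V, ?_⟩ ⟨s, hs, rfl⟩
  rintro _ ⟨t, -, rfl⟩
  exact ncard_le_card t

lemma exists_indepSet_ncard_eq_alphaNum : ∃ s, IndepSet G s ∧ s.ncard = alphaNum G := by
  have hne : {n | ∃ s : Set V, IndepSet G s ∧ s.ncard = n}.Nonempty :=
    ⟨0, ∅, fun _ h => h.elim, ncard_empty V⟩
  refine Nat.sSup_mem hne ⟨Nat.card V, ?_⟩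
  rintro _ ⟨t, -, rfl⟩
  exact ncard_le_card t

/-- Every independent subset of `S` extends to a maximal one. -/
lemma exists_isMaxIndepIn_superset {S J : Set V} (hJS : J ⊆ S) (hJ : IndepSet G J) :
    ∃ K, J ⊆ K ∧ IsMaxIndepIn G S K := by
  obtain ⟨K, hJK, hK⟩ :=
    (toFinite {K : Set V | K ⊆ S ∧ IndepSet G K}).exists_le_maximal (a := J) ⟨hJS, hJ⟩
  refine ⟨K, hJK, hK.prop.1, hK.prop.2, fun v hvS hvK => ?_⟩
  by_contra! hcon
  refine hvK (hK.le_of_ge ⟨insert_subset hvS hK.prop.1, ?_⟩ (subset_insert v K) (mem_insert v K))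
  rintro a (rfl | ha) b (rfl | hb) hab
  · exact G.irrefl hab
  · exact hcon b hb hab.symm
  · exact hcon a ha hab
  · exact hK.prop.2 ha hb hab

lemma exists_maxIndepSet_ncard_eq_iNum : ∃ s, MaxIndepSet G s ∧ s.ncard = iNum G := by
  obtain ⟨K, -, hK⟩ := exists_isMaxIndepIn_superset G (empty_subset univ) (fun _ h => h.elim)
  exact Nat.sInf_mem
    (s := {n | ∃ s : Set V, MaxIndepSet G s ∧ s.ncard = n}) ⟨_, K, (maxIndepSet_iff G K).2 hK, rfl⟩

lemma ncard_le_alphaNum_induce {G : SimpleGraph V} {S J : Set V} (hJS : J ⊆ S)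
    (hJ : IndepSet G J) : J.ncard ≤ alphaNum (G.induce S) := by
  have h : IndepSet (G.induce S) (Subtype.val ⁻¹' J) := fun a ha b hb hab => hJ ha hb hab
  have hcard := h.ncard_le_alphaNum
  rwa [ncard_preimage_of_injective_subset_range Subtype.val_injective (by simpa using hJS)] at hcard

lemma exists_ncard_eq_alphaNum_induce (S : Set V) :
    ∃ J ⊆ S, IndepSet G J ∧ J.ncard = alphaNum (G.induce S) := by
  obtain ⟨s, hs, hcard⟩ := exists_indepSet_ncard_eq_alphaNum (G.induce S)
  refine ⟨Subtype.val '' s, Subtype.coe_image_subset S s, ?_, ?_⟩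
  · rintro _ ⟨a, ha, rfl⟩ _ ⟨b, hb, rfl⟩ hab
    exact hs ha hb hab
  · rw [ncard_image_of_injective _ Subtype.val_injective, hcard]

lemma exists_ncard_eq_iNum_induce (S : Set V) :
    ∃ J, IsMaxIndepIn G S J ∧ J.ncard = iNum (G.induce S) := by
  obtain ⟨s, hs, hcard⟩ := exists_maxIndepSet_ncard_eq_iNum (G.induce S)
  rw [maxIndepSet_iff] at hs
  refine ⟨Subtype.val '' s, ⟨Subtype.coe_image_subset S s, ?_, fun v hvS hv => ?_⟩, ?_⟩
  · rintro _ ⟨a, ha, rfl⟩ _ ⟨b, hb, rfl⟩ hab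
    exact hs.2.1 ha hb hab
  · obtain ⟨u, hu, huv⟩ := hs.2.2 ⟨v, hvS⟩ (mem_univ _) fun h => hv ⟨_, h, rfl⟩
    exact ⟨u, ⟨u, hu, rfl⟩, huv⟩
  · rw [ncard_image_of_injective _ Subtype.val_injective, hcard]

end Numbers

/-- The vertices outside `T₀` are matched by pendant edges: each `t ∈ T₁` is the unique neighbor
of the vertex `leaf t`, and `T₀`, `T₁` and `leaf '' T₁` partition the vertex set. -/
structure PendantPartition {V : Type*} (G : SimpleGraph V) (T₀ T₁ : Set V) (leaf : V → V) :
    Prop where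
  notMem_one : ∀ v ∈ T₀, v ∉ T₁
  cover : ∀ v, v ∉ T₀ → v ∉ T₁ → ∃ t ∈ T₁, leaf t = v
  leaf_notMem_zero : ∀ t ∈ T₁, leaf t ∉ T₀
  leaf_notMem_one : ∀ t ∈ T₁, leaf t ∉ T₁
  adj_leaf : ∀ t ∈ T₁, ∀ x, G.Adj (leaf t) x ↔ x = t

namespace PendantPartition

variable {V : Type*} {G : SimpleGraph V} {T₀ T₁ : Set V} {leaf : V → V}

lemma injOn_leaf (h : PendantPartition G T₀ T₁ leaf) : InjOn leaf T₁ := fun t ht t' ht' heq =>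
  (h.adj_leaf t' ht' t).1 (heq ▸ (h.adj_leaf t ht t).2 rfl)

/-- An independent set stays independent after adding the leaves at vertices of `T₁` outside it. -/
lemma indepSet_union_leaf (h : PendantPartition G T₀ T₁ leaf) {S : Set V} (hS : IndepSet G S) :
    IndepSet G (S ∪ leaf '' (T₁ \ S)) := by
  rintro a (ha | ⟨t, ht, rfl⟩) b (hb | ⟨t', ht', rfl⟩) hab
  · exact hS ha hb hab
  · exact ht'.2 ((h.adj_leaf t' ht'.1 a).1 hab.symm ▸ ha)
  · exact ht.2 ((h.adj_leaf t ht.1 b).1 hab ▸ hb)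
  · exact h.leaf_notMem_one t' ht'.1 ((h.adj_leaf t ht.1 _).1 hab ▸ ht.1)

open Classical in
/-- Choosing one endpoint of each pendant edge yields `|T₁|` distinct vertices. -/
lemma ncard_image_ite (h : PendantPartition G T₀ T₁ leaf) (S : Set V) :
    ((fun t => if t ∈ S then t else leaf t) '' T₁).ncard = T₁.ncard := by
  refine InjOn.ncard_image fun t ht t' ht' heq => ?_
  split_ifs at heq with h₁ h₂ h₂
  · exact heq
  · exact (h.leaf_notMem_one t' ht' (heq ▸ ht)).elim
  · exact (h.leaf_notMem_one t ht (heq ▸ ht')).elim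
  · exact h.injOn_leaf ht ht' heq

variable [Finite V]

lemma ncard_diff_le (h : PendantPartition G T₀ T₁ leaf) {S : Set V} (hS : IndepSet G S) :
    (S \ T₀).ncard ≤ T₁.ncard := by
  classical
  rw [← h.ncard_image_ite S]
  refine ncard_le_ncard ?_
  rintro v ⟨hv, hv₀⟩
  by_cases hv₁ : v ∈ T₁
  · exact ⟨v, hv₁, if_pos hv⟩
  · obtain ⟨t, ht, rfl⟩ := h.cover v hv₀ hv₁
    exact ⟨t, ht, if_neg fun htS => hS hv htS ((h.adj_leaf t ht t).2 rfl)⟩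

lemma le_ncard_diff (h : PendantPartition G T₀ T₁ leaf) {S : Set V}
    (hS : ∀ v, v ∉ S → ∃ u ∈ S, G.Adj u v) : T₁.ncard ≤ (S \ T₀).ncard := by
  classical
  rw [← h.ncard_image_ite S]
  refine ncard_le_ncard ?_
  rintro _ ⟨t, ht, rfl⟩
  by_cases htS : t ∈ S
  · simp only [htS, if_true]
    exact ⟨htS, fun h₀ => h.notMem_one t h₀ ht⟩
  · simp only [htS, if_false]
    refine ⟨?_, h.leaf_notMem_zero t ht⟩
    by_contra hl
    obtain ⟨u, hu, hut⟩ := hS _ hl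
    exact htS ((h.adj_leaf t ht u).1 hut.symm ▸ hu)

lemma alphaNum_eq (h : PendantPartition G T₀ T₁ leaf) :
    alphaNum G = alphaNum (G.induce T₀) + T₁.ncard := by
  apply le_antisymm
  · obtain ⟨S, hS, hcard⟩ := exists_indepSet_ncard_eq_alphaNum G
    rw [← hcard, ← ncard_inter_add_ncard_sdiff_eq_ncard S T₀]
    exact add_le_add (ncard_le_alphaNum_induce inter_subset_right
      fun a ha b hb => hS ha.1 hb.1) (h.ncard_diff_le hS)
  · obtain ⟨J, hJ₀, hJ, hcard⟩ := exists_ncard_eq_alphaNum_induce G T₀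
    have hdiff : T₁ \ J = T₁ :=
      sdiff_eq_left.2 (disjoint_left.2 fun t ht htJ => h.notMem_one t (hJ₀ htJ) ht)
    have hle := (h.indepSet_union_leaf hJ).ncard_le_alphaNum
    rwa [hdiff, ncard_union_eq, h.injOn_leaf.ncard_image, hcard] at hle
    rw [disjoint_left]
    rintro _ hv ⟨t, ht, rfl⟩
    exact h.leaf_notMem_zero t ht (hJ₀ hv)

lemma iNum_le (h : PendantPartition G T₀ T₁ leaf) {I : Set V} (hI : IndepSet G I) (hI₁ : I ⊆ T₁) :
    iNum G ≤ iNum (G.induce (T₀ \ nbhd G I)) + T₁.ncard := by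
  obtain ⟨J, ⟨hJ₀, hJ, hmax⟩, hcard⟩ := exists_ncard_eq_iNum_induce G (T₀ \ nbhd G I)
  have hIJ : IndepSet G (J ∪ I) := by
    rintro a (ha | ha) b (hb | hb) hab
    · exact hJ ha hb hab
    · exact (hJ₀ ha).2 ⟨b, hb, hab.symm⟩
    · exact (hJ₀ hb).2 ⟨a, ha, hab⟩
    · exact hI ha hb hab
  have hK := h.indepSet_union_leaf hIJ
  obtain ⟨K, hKdef⟩ : ∃ K, K = J ∪ I ∪ leaf '' (T₁ \ (J ∪ I)) := ⟨_, rfl⟩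
  rw [← hKdef] at hK
  have hKmax : MaxIndepSet G K := by
    rw [maxIndepSet_iff]
    refine ⟨subset_univ _, hK, fun v _ hv => ?_⟩
    have hvJ : v ∉ J := fun hvJ => hv (hKdef ▸ Or.inl (Or.inl hvJ))
    have hvI : v ∉ I := fun hvI => hv (hKdef ▸ Or.inl (Or.inr hvI))
    by_cases hv₀ : v ∈ T₀
    · by_cases hvN : v ∈ nbhd G I
      · obtain ⟨u, hu, huv⟩ := hvN
        exact ⟨u, hKdef ▸ Or.inl (Or.inr hu), huv⟩
      · obtain ⟨u, hu, huv⟩ := hmax v ⟨hv₀, hvN⟩ hvJ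
        exact ⟨u, hKdef ▸ Or.inl (Or.inl hu), huv⟩
    · by_cases hv₁ : v ∈ T₁
      · exact ⟨leaf v, hKdef ▸ Or.inr ⟨v, ⟨hv₁, fun h' => h'.elim hvJ hvI⟩, rfl⟩,
          (h.adj_leaf v hv₁ v).2 rfl⟩
      · obtain ⟨t, ht, rfl⟩ := h.cover v hv₀ hv₁
        refine ⟨t, ?_, ((h.adj_leaf t ht t).2 rfl).symm⟩
        by_contra htK
        exact hv (hKdef ▸ Or.inr ⟨t, ⟨ht, fun h' => htK (hKdef ▸ Or.inl h')⟩, rfl⟩)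
  have hKJ : K ∩ T₀ ⊆ J := by
    rw [hKdef]
    rintro v ⟨(hv | hv) | ⟨t, ht, rfl⟩, hv₀⟩
    · exact hv
    · exact (h.notMem_one v hv₀ (hI₁ hv)).elim
    · exact (h.leaf_notMem_zero t ht.1 hv₀).elim
  calc iNum G ≤ K.ncard := hKmax.iNum_le_ncard
    _ = (K ∩ T₀).ncard + (K \ T₀).ncard := (ncard_inter_add_ncard_sdiff_eq_ncard K T₀).symm
    _ ≤ _ := add_le_add (hcard ▸ ncard_le_ncard hKJ) (h.ncard_diff_le hK)

lemma exists_le_iNum (h : PendantPartition G T₀ T₁ leaf) :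
    ∃ I ⊆ T₁, IndepSet G I ∧ iNum (G.induce (T₀ \ nbhd G I)) + T₁.ncard ≤ iNum G := by
  obtain ⟨S, hS, hcard⟩ := exists_maxIndepSet_ncard_eq_iNum G
  rw [maxIndepSet_iff] at hS
  refine ⟨S ∩ T₁, inter_subset_right, fun a ha b hb => hS.2.1 ha.1 hb.1, ?_⟩
  rw [← hcard, ← ncard_inter_add_ncard_sdiff_eq_ncard S T₀]
  refine add_le_add (IsMaxIndepIn.iNum_induce_le ⟨?_, ?_, ?_⟩)
    (h.le_ncard_diff fun v hv => hS.2.2 v (mem_univ v) hv)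
  · rintro v ⟨hv, hv₀⟩
    exact ⟨hv₀, fun ⟨u, hu, huv⟩ => hS.2.1 hu.1 hv huv⟩
  · exact fun a ha b hb => hS.2.1 ha.1 hb.1
  · rintro v ⟨hv₀, hvN⟩ hv
    obtain ⟨u, hu, huv⟩ := hS.2.2 v (mem_univ v) fun hvS => hv ⟨hvS, hv₀⟩
    refine ⟨u, ⟨hu, ?_⟩, huv⟩
    by_contra hu₀
    by_cases hu₁ : u ∈ T₁
    · exact hvN ⟨u, ⟨hu, hu₁⟩, huv⟩
    · obtain ⟨t, ht, rfl⟩ := h.cover u hu₀ hu₁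
      exact h.notMem_one v hv₀ ((h.adj_leaf t ht v).1 huv ▸ ht)

lemma indepGap_le_iff (h : PendantPartition G T₀ T₁ leaf) (k : ℕ) :
    indepGap G ≤ k ↔ ∀ I : Set V, IndepSet G I → I ⊆ T₁ →
      alphaNum (G.induce T₀) - iNum (G.induce (T₀ \ nbhd G I)) ≤ k := by
  rw [indepGap, h.alphaNum_eq]
  constructor
  · intro hk I hI hI₁
    have := h.iNum_le hI hI₁
    omega
  · intro hall
    obtain ⟨I, hI₁, hI, hle⟩ := h.exists_le_iNum
    have := hall I hI hI₁
    omega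

end PendantPartition

/-- A sum of integers that is at least `m` has a subsum with at most `m` terms that is at
least `m`. -/
lemma exists_subset_card_le_le_sum {ι : Type*} (s : Finset ι) (f : ι → ℤ) (m : ℕ)
    (hm : (m : ℤ) ≤ ∑ i ∈ s, f i) : ∃ D ⊆ s, D.card ≤ m ∧ (m : ℤ) ≤ ∑ i ∈ D, f i := by
  classical
  induction m with
  | zero => exact ⟨∅, by simp⟩
  | succ m ih =>
    push_cast at hm
    obtain ⟨D, hDs, hD, hsum⟩ := ih (by omega)
    by_cases hlt : (m : ℤ) + 1 ≤ ∑ i ∈ D, f i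
    · exact ⟨D, hDs, by omega, by exact_mod_cast hlt⟩
    · have hsplit := Finset.sum_sdiff (f := f) hDs
      obtain ⟨i, hi, hpos⟩ : ∃ i ∈ s \ D, 0 < f i :=
        Finset.exists_lt_of_sum_lt (by simp only [Finset.sum_const_zero]; omega)
      rw [Finset.mem_sdiff] at hi
      refine ⟨insert i D, Finset.insert_subset hi.1 hDs, ?_, ?_⟩
      · rw [Finset.card_insert_of_notMem hi.2]
        omega
      · rw [Finset.sum_insert hi.2]
        push_cast
        omega

section Localization

variable {V : Type*} [Finite V] (G : SimpleGraph V)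

lemma ncard_supp_le_maxCompCard (c : G.ConnectedComponent) :
    c.supp.ncard ≤ maxCompCard G := by
  refine le_csSup ⟨Nat.card V, ?_⟩ ⟨c, rfl⟩
  rintro _ ⟨c', rfl⟩
  exact ncard_le_card _

/-- If `A` exceeds `J` by at least `m`, then it does so on a union `W` of at most `m` components
of the graph induced by `T`. -/
lemma exists_union_components {T A J : Set V} (hA : A ⊆ T) (hJ : J ⊆ T) (m : ℕ)
    (hm : J.ncard + m ≤ A.ncard) :
    ∃ W ⊆ T, (∀ a ∈ W, ∀ b ∈ T, G.Adj a b → b ∈ W) ∧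
      W.ncard ≤ m * maxCompCard (G.induce T) ∧ (J ∩ W).ncard + m ≤ (A ∩ W).ncard := by
  have := Fintype.ofFinite (G.induce T).ConnectedComponent
  let part (c : (G.induce T).ConnectedComponent) : Set V := Subtype.val '' c.supp
  have hdisj (B : Set V) (D : Finset (G.induce T).ConnectedComponent) :
      (B ∩ ⋃ c ∈ D, part c).ncard = ∑ c ∈ D, (B ∩ part c).ncard := by
    rw [inter_iUnion₂, ← finsum_mem_coe_finset]
    refine D.finite_toSet.ncard_biUnion (fun _ _ => toFinite _) fun c _ c' _ hcc' => ?_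
    refine disjoint_left.2 ?_
    rintro _ ⟨-, a, ha, rfl⟩ ⟨-, b, hb, hba⟩
    obtain rfl := Subtype.val_injective hba
    exact hcc' (ha.symm.trans hb)
  have hall (B : Set V) (hB : B ⊆ T) : B.ncard = ∑ c, (B ∩ part c).ncard := by
    rw [← hdisj, inter_eq_left.2]
    intro v hv
    exact mem_iUnion₂.2 ⟨(G.induce T).connectedComponentMk ⟨v, hB hv⟩, Finset.mem_univ _,
      ⟨v, hB hv⟩, rfl, rfl⟩
  obtain ⟨D, -, hD, hsum⟩ := exists_subset_card_le_le_sum Finset.univ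
    (fun c => ((A ∩ part c).ncard : ℤ) - ((J ∩ part c).ncard : ℤ)) m (by
      rw [Finset.sum_sub_distrib, ← Nat.cast_sum, ← Nat.cast_sum, ← hall A hA, ← hall J hJ]
      omega)
  refine ⟨⋃ c ∈ D, part c, ?_, ?_, ?_, ?_⟩
  · exact iUnion₂_subset fun c _ => Subtype.coe_image_subset T _
  · intro a ha b hb hab
    obtain ⟨c, hc, a, hac, rfl⟩ := mem_iUnion₂.1 ha
    have hadj : (G.induce T).Adj a ⟨b, hb⟩ := hab
    exact mem_iUnion₂.2 ⟨c, hc, ⟨b, hb⟩, (c.mem_supp_congr_adj hadj).1 hac, rfl⟩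
  · rw [← univ_inter (⋃ c ∈ D, part c), hdisj]
    refine (Finset.sum_le_card_nsmul D _ (maxCompCard (G.induce T)) fun c _ => ?_).trans ?_
    · rw [univ_inter, ncard_image_of_injective _ Subtype.val_injective]
      exact ncard_supp_le_maxCompCard _ c
    · exact Nat.mul_le_mul_right _ hD
  · rw [hdisj, hdisj]
    rw [Finset.sum_sub_distrib, ← Nat.cast_sum, ← Nat.cast_sum] at hsum
    omega

lemma exists_subset_nbhd_inter_eq (I W : Set V) :
    ∃ I' ⊆ I, I'.ncard ≤ W.ncard ∧ nbhd G I' ∩ W = nbhd G I ∩ W := by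
  choose! f hf using fun (v : V) (hv : v ∈ nbhd G I) => hv
  refine ⟨f '' (nbhd G I ∩ W), ?_, ?_, ?_⟩
  · rintro _ ⟨v, hv, rfl⟩
    exact (hf v hv.1).1
  · exact (ncard_image_le (toFinite _)).trans (ncard_le_ncard inter_subset_right)
  · ext v
    constructor
    · rintro ⟨⟨_, ⟨w, hw, rfl⟩, hadj⟩, hvW⟩
      exact ⟨⟨f w, (hf w hw.1).1, hadj⟩, hvW⟩
    · exact fun hv => ⟨⟨f v, ⟨v, hv, rfl⟩, (hf v hv.1).2⟩, hv.2⟩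

/-- A set `I` witnessing a large value of `α(G[T]) - i(G[T] - N(I))` can be shrunk to a small one. -/
lemma exists_small_subset_of_lt (T I : Set V) (k : ℕ)
    (hk : k < alphaNum (G.induce T) - iNum (G.induce (T \ nbhd G I))) :
    ∃ I' ⊆ I, I'.ncard ≤ (k + 1) * maxCompCard (G.induce T) ∧
      k < alphaNum (G.induce T) - iNum (G.induce (T \ nbhd G I')) := by
  obtain ⟨A, hAT, hA, hAcard⟩ := exists_ncard_eq_alphaNum_induce G T
  obtain ⟨J, ⟨hJT, hJ, hJmax⟩, hJcard⟩ := exists_ncard_eq_iNum_induce G (T \ nbhd G I)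
  obtain ⟨W, hWT, hclosed, hWcard, hgap⟩ := exists_union_components G hAT
    (hJT.trans sdiff_subset) (k + 1) (by omega)
  obtain ⟨I', hI'I, hI'card, hN⟩ := exists_subset_nbhd_inter_eq G I W
  have hNmem {v : V} (hv : v ∈ W) : v ∈ nbhd G I' ↔ v ∈ nbhd G I := by
    simpa [hv] using Set.ext_iff.1 hN v
  refine ⟨I', hI'I, hI'card.trans hWcard, ?_⟩
  obtain ⟨K, hJK, hK⟩ := exists_isMaxIndepIn_superset G (S := T \ nbhd G I') (J := J ∩ W)
    (fun v hv => ⟨hWT hv.2, fun h => (hJT hv.1).2 ((hNmem hv.2).1 h)⟩)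
    (fun a ha b hb => hJ ha.1 hb.1)
  have hKW : K ∩ W ⊆ J ∩ W := by
    rintro v ⟨hvK, hvW⟩
    refine ⟨?_, hvW⟩
    by_contra hvJ
    obtain ⟨u, hu, huv⟩ :=
      hJmax v ⟨hWT hvW, fun h => (hK.1 hvK).2 ((hNmem hvW).2 h)⟩ hvJ
    exact hK.2.1 (hJK ⟨hu, hclosed v hvW u (hJT hu).1 huv.symm⟩) hvK huv
  have hswap : (A ∩ W ∪ K \ W).ncard ≤ alphaNum (G.induce T) := by
    refine ncard_le_alphaNum_induce
      (union_subset (inter_subset_left.trans hAT) fun v hv => (hK.1 hv.1).1) ?_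
    rintro a (ha | ha) b (hb | hb) hab
    · exact hA ha.1 hb.1 hab
    · exact hb.2 (hclosed a ha.2 b (hK.1 hb.1).1 hab)
    · exact ha.2 (hclosed b hb.2 a (hK.1 ha.1).1 hab.symm)
    · exact hK.2.1 ha.1 hb.1 hab
  rw [ncard_union_eq (disjoint_left.2 fun v hv hv' => hv'.2 hv.2)] at hswap
  have hKle := hK.iNum_induce_le
  rw [← ncard_inter_add_ncard_sdiff_eq_ncard K W] at hKle
  have := ncard_le_ncard hKW
  omega

end Localization

section Leaves

variable {V : Type*} {G : SimpleGraph V}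

lemma mem_completeU_of_adj {u v : V} (huv : G.Adj u v) (hu : u ∈ completeU G) :
    v ∈ completeU G := by
  have h : G.connectedComponentMk u = G.connectedComponentMk v :=
    SimpleGraph.ConnectedComponent.connectedComponentMk_eq_of_adj huv
  rwa [completeU, mem_ofPred_eq, ← h]

lemma IsLeaf.exists_forall_adj_iff {l : V} (hl : IsLeaf G l) : ∃ x, ∀ y, G.Adj l y ↔ y = x := by
  obtain ⟨x, hx⟩ := ncard_eq_one.1 hl.2
  refine ⟨x, fun y => ?_⟩
  have hy := Set.ext_iff.1 hx y
  rw [mem_ofPred_eq, mem_singleton_iff] at hy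
  rw [← hy]
  exact ⟨fun h => ⟨fun hU => hl.1 (mem_completeU_of_adj h.symm hU), h⟩, And.right⟩

lemma IsLeaf.not_isLeaf_of_adj {l x : V} (hl : IsLeaf G l) (hlx : G.Adj l x) : ¬ IsLeaf G x := by
  intro hx
  obtain ⟨x', hx'⟩ := hl.exists_forall_adj_iff
  obtain rfl := (hx' x).1 hlx
  obtain ⟨l', hl'⟩ := hx.exists_forall_adj_iff
  obtain rfl := (hl' l).1 hlx.symm
  have hreach : ∀ y, G.Reachable y l → y = l ∨ y = x := by
    intro y hy
    rw [SimpleGraph.reachable_iff_reflTransGen] at hy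
    induction hy using Relation.ReflTransGen.head_induction_on with
    | refl => exact Or.inl rfl
    | head hab _ ih =>
      rcases ih with rfl | rfl
      · exact Or.inr ((hx' _).1 hab.symm)
      · exact Or.inl ((hl' _).1 hab.symm)
  refine hl.1 fun a ha b hb hab => ?_
  rcases hreach a (SimpleGraph.ConnectedComponent.exact ha) with rfl | rfl <;>
  rcases hreach b (SimpleGraph.ConnectedComponent.exact hb) with rfl | rfl
  · exact (hab rfl).elim
  · exact hlx
  · exact hlx.symm
  · exact (hab rfl).elim

lemma IsLeaf.isInternal_of_adj {l x : V} (hl : IsLeaf G l) (hlx : G.Adj l x) : IsInternal G x :=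
  ⟨fun hx => hl.1 (mem_completeU_of_adj hlx.symm hx), hl.not_isLeaf_of_adj hlx⟩

lemma IsLeaf.notMem_typeSet {l : V} (hl : IsLeaf G l) (n : ℕ) : l ∉ typeSet G n := by
  rintro (h | h)
  · exact h.1.2 hl
  · exact hl.1 h.1

lemma exists_leaf_of_mem_typeSet_one {t : V} (ht : t ∈ typeSet G 1) :
    ∃ l, IsLeaf G l ∧ G.Adj t l ∧ ∀ l', IsLeaf G l' → G.Adj t l' → l' = l := by
  rcases ht with ⟨-, h⟩ | ⟨-, h⟩
  · obtain ⟨l, hl⟩ := ncard_eq_one.1 h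
    have hmem : l ∈ {u | IsLeaf G u ∧ G.Adj t u} := hl ▸ mem_singleton l
    exact ⟨l, hmem.1, hmem.2, fun l' h₁ h₂ =>
      mem_singleton_iff.1 (hl ▸ (⟨h₁, h₂⟩ : l' ∈ {u | IsLeaf G u ∧ G.Adj t u}))⟩
  · exact absurd h one_ne_zero

lemma exists_pendantPartition [Finite V]
    (htypes : ∀ v : V, IsInternal G v → HasType G v 0 ∨ HasType G v 1) :
    ∃ leaf, PendantPartition G (typeSet G 0) (typeSet G 1) leaf := by
  choose! leaf hleaf hadj huniq using
    fun (t : V) (ht : t ∈ typeSet G 1) => exists_leaf_of_mem_typeSet_one ht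
  refine ⟨leaf, ?_, ?_, fun t ht => (hleaf t ht).notMem_typeSet 0,
    fun t ht => (hleaf t ht).notMem_typeSet 1, fun t ht x => ?_⟩
  · rintro v (⟨hv, h0⟩ | ⟨hv, -⟩) (⟨hv', h1⟩ | ⟨hv', h1⟩)
    · omega
    · omega
    · exact hv'.1 hv
    · omega
  · intro v h₀ h₁
    have hU : v ∉ completeU G := fun hU => h₀ (Or.inr ⟨hU, rfl⟩)
    have hv : IsLeaf G v := by
      by_contra hv
      exact (htypes v ⟨hU, hv⟩).elim h₀ h₁
    obtain ⟨x, hx⟩ := hv.exists_forall_adj_iff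
    have hvx := (hx x).2 rfl
    have hx₁ : x ∈ typeSet G 1 := by
      have hint := hv.isInternal_of_adj hvx
      refine (htypes x hint).resolve_left ?_
      rintro (⟨-, h⟩ | ⟨h, -⟩)
      · rw [ncard_eq_zero] at h
        exact (h ▸ (⟨hv, hvx.symm⟩ : v ∈ {u | IsLeaf G u ∧ G.Adj x u}) : v ∈ (∅ : Set V))
      · exact hint.1 h
    exact ⟨x, hx₁, (huniq x hx₁ v hv hvx.symm).symm⟩
  · obtain ⟨y, hy⟩ := (hleaf t ht).exists_forall_adj_iff
    rw [hy, (hy t).1 (hadj t ht).symm]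

end Leaves

/-- For a graph all of whose internal vertices are of type 0 or 1 and with
`G₀` non-null, `μ_α(G) ≤ k` iff `μ_α(G₀) ≤ k` and every independent set `I ⊆ V(G₁)` with
`|I| ≤ (k+1)·n₀` satisfies `α(G₀) − i(G₀ − N(I)) ≤ k`. -/
theorem gap_le_iff_types01 {V : Type*} [Fintype V] (G : SimpleGraph V) (k : ℕ)
    (htypes : ∀ v : V, IsInternal G v → HasType G v 0 ∨ HasType G v 1)
    (hne : (typeSet G 0).Nonempty)
    (n0 : ℕ) (hn0 : n0 = maxCompCard (G.induce (typeSet G 0))) :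
    indepGap G ≤ k ↔
      indepGap (G.induce (typeSet G 0)) ≤ k ∧
        ∀ I : Set V, IndepSet G I → I ⊆ typeSet G 1 → I.ncard ≤ (k + 1) * n0 →
          alphaNum (G.induce (typeSet G 0)) -
            iNum (G.induce (typeSet G 0 \ nbhd G I)) ≤ k := by
  obtain ⟨leaf, hleaf⟩ := exists_pendantPartition htypes
  rw [hleaf.indepGap_le_iff, hn0]
  constructor
  · refine fun hall => ⟨?_, fun I hI hI₁ _ => hall I hI hI₁⟩
    have hempty := hall ∅ (fun _ h => h.elim) (empty_subset _)
    have hN : nbhd G ∅ = ∅ := eq_empty_of_forall_notMem fun _ ⟨_, hu, _⟩ => hu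
    rwa [hN, sdiff_empty] at hempty
  · rintro ⟨-, hall⟩ I hI hI₁
    by_contra! hlt
    obtain ⟨I', hI'I, hcard, hlt'⟩ := exists_small_subset_of_lt G (typeSet G 0) I k hlt
    exact hlt'.not_ge
      (hall I' (fun a ha b hb => hI (hI'I ha) (hI'I hb)) (hI'I.trans hI₁) hcard)
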